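/- arXiv:2412.06379 — 2 statements merged into one kernel-verified Lean document; each statement's English description precedes it below -/
import Mathlib

section
/- Let A be an n×n sign pattern of cycle form such that D(A_+) contains a directed cycle of length n. If A requires algebraic positivity, then no vertex of D(A) is covered by both a positive directed 2-cycle and a negative directed 2-cycle. -/
open Matrix

/-- A real square matrix is algebraically positive if some real polynomial
evaluated at it has all entries positive. -/
def AlgPositive {n : ℕ} (M : Matrix (Fin n) (Fin n) ℝ) : Prop :=
  ∃ f : Polynomial ℝ, ∀ i j, 0 < Polynomial.aeval M f i j

/-- `B` belongs to the qualitative class of the sign pattern `A`. -/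
def InQClass {n : ℕ} (A : Matrix (Fin n) (Fin n) SignType)
    (B : Matrix (Fin n) (Fin n) ℝ) : Prop :=
  ∀ i j, SignType.sign (B i j) = A i j

/-- The sign pattern `A` requires algebraic positivity. -/
def RequiresAP {n : ℕ} (A : Matrix (Fin n) (Fin n) SignType) : Prop :=
  ∀ B : Matrix (Fin n) (Fin n) ℝ, InQClass A B → AlgPositive B

/-- An `n × n` sign pattern (indices read modulo `n`) is of cycle form if off-diagonal
entries away from the cycle `(0, 1, …, n-1, 0)` vanish and every edge of the cycle
carries at least one nonzero arc. -/
def CycleForm {n : ℕ} [NeZero n] (A : Matrix (Fin n) (Fin n) SignType) : Prop :=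
  (∀ i j : Fin n, i ≠ j → j ≠ i + 1 → i ≠ j + 1 → A i j = 0) ∧
  (∀ i : Fin n, A i (i + 1) ≠ 0 ∨ A (i + 1) i ≠ 0)

/-- For a cycle-form pattern, `D(A_+)` contains a directed cycle of length `n`. -/
def PlusNCycle {n : ℕ} [NeZero n] (A : Matrix (Fin n) (Fin n) SignType) : Prop :=
  (∀ i : Fin n, A i (i + 1) = 1) ∨ (∀ i : Fin n, A (i + 1) i = 1)

/-- For a cycle-form pattern, `D(A_-)` contains a directed cycle of length `n`. -/
def MinusNCycle {n : ℕ} [NeZero n] (A : Matrix (Fin n) (Fin n) SignType) : Prop :=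
  (∀ i : Fin n, A i (i + 1) = -1) ∨ (∀ i : Fin n, A (i + 1) i = -1)

/-- An entrywise positive matrix has a positive real eigenvector (Perron). -/
theorem exists_pos_eigenvector {ι : Type*} [Fintype ι] [Nonempty ι] (P : Matrix ι ι ℝ)
    (hP : ∀ i j, 0 < P i j) :
    ∃ (t : ℝ) (x : ι → ℝ), (∀ i, 0 < x i) ∧ P *ᵥ x = t • x := by
  classical
  have mulVec_pos : ∀ v : ι → ℝ, 0 ≤ v → v ≠ 0 → ∀ i, 0 < (P *ᵥ v) i := by
    intro v hv hne i
    obtain ⟨j, hj⟩ := Function.ne_iff.mp hne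
    exact Finset.sum_pos' (fun k _ => mul_nonneg (hP i k).le (hv k))
      ⟨j, Finset.mem_univ j, mul_pos (hP i j) (lt_of_le_of_ne (hv j) (Ne.symm hj))⟩
  set C : ℝ := ∑ i, ∑ j, P i j
  have le_C : ∀ (t : ℝ) (x : ι → ℝ), x ∈ stdSimplex ℝ ι → (∀ i, t * x i ≤ (P *ᵥ x) i) →
      t ≤ C := by
    intro t x hx h
    calc t = ∑ i, t * x i := by rw [← Finset.mul_sum, hx.2, mul_one]
      _ ≤ ∑ i, (P *ᵥ x) i := Finset.sum_le_sum fun i _ => h i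
      _ ≤ C := Finset.sum_le_sum fun i _ => Finset.sum_le_sum fun j _ =>
        mul_le_of_le_one_right (hP i j).le (mem_Icc_of_mem_stdSimplex hx j).2
  let T : Set (ℝ × (ι → ℝ)) :=
    (Set.Icc 0 C ×ˢ stdSimplex ℝ ι) ∩ {p | ∀ i, p.1 * p.2 i ≤ (P *ᵥ p.2) i}
  have hT : IsCompact T := by
    refine (isCompact_Icc.prod (isCompact_stdSimplex ℝ ι)).inter_right ?_
    simp only [Set.ofPred_forall]
    exact isClosed_iInter fun i => isClosed_le (by fun_prop)
      ((continuous_apply i).comp (Continuous.matrix_mulVec continuous_const continuous_snd))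
  have C_nonneg : 0 ≤ C := Finset.sum_nonneg fun i _ => Finset.sum_nonneg fun j _ => (hP i j).le
  have hTne : T.Nonempty := by
    let i₀ := Classical.arbitrary ι
    have hs := single_mem_stdSimplex ℝ i₀
    refine ⟨(0, Pi.single i₀ 1), ⟨⟨le_rfl, C_nonneg⟩, hs⟩, fun i => ?_⟩
    simpa using (hP i i₀).le
  obtain ⟨⟨t, x⟩, ⟨⟨ht, hx⟩, hle⟩, hmax⟩ := hT.exists_isMaxOn hTne continuous_fst.continuousOn
  simp only [Set.mem_ofPred_eq] at ht hx hle
  have hx0 : x ≠ 0 := by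
    rintro rfl
    simpa using hx.2
  have hz := mulVec_pos x hx.1 hx0
  have heq : P *ᵥ x = t • x := by
    by_contra hne
    set w := P *ᵥ x - t • x with hw
    have hPw := mulVec_pos w (fun i => by simpa [hw] using hle i) (sub_ne_zero.mpr hne)
    set z := P *ᵥ x with hzdef
    obtain ⟨m, -, hm⟩ := Finset.exists_min_image Finset.univ (fun i => (P *ᵥ w) i / z i)
      Finset.univ_nonempty
    set δ := (P *ᵥ w) m / z m
    have hδ : 0 < δ := div_pos (hPw m) (hz m)
    have hPz : ∀ i, (t + δ) * z i ≤ (P *ᵥ z) i := by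
      intro i
      have h1 : δ * z i ≤ (P *ᵥ w) i := (le_div_iff₀ (hz i)).mp (hm i (Finset.mem_univ i))
      have h2 : (P *ᵥ w) i = (P *ᵥ z) i - t * z i := by
        rw [hw, mulVec_sub, mulVec_smul]
        simp [hzdef]
      linarith
    set S := ∑ i, z i
    have hS : 0 < S := Finset.sum_pos (fun i _ => hz i) Finset.univ_nonempty
    have hmem : S⁻¹ • z ∈ stdSimplex ℝ ι := by
      refine ⟨fun i => mul_nonneg (inv_nonneg.mpr hS.le) (hz i).le, ?_⟩
      simp only [Pi.smul_apply, smul_eq_mul]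
      rw [← Finset.mul_sum, inv_mul_cancel₀ hS.ne']
    have hle' : ∀ i, (t + δ) * (S⁻¹ • z) i ≤ (P *ᵥ (S⁻¹ • z)) i := by
      intro i
      rw [mulVec_smul]
      simp only [Pi.smul_apply, smul_eq_mul]
      have := mul_le_mul_of_nonneg_left (hPz i) (inv_nonneg.mpr hS.le)
      linarith
    have h3 : t + δ ≤ t := hmax (a := (t + δ, S⁻¹ • z))
      ⟨⟨⟨add_nonneg ht.1 hδ.le, le_C _ _ hmem hle'⟩, hmem⟩, hle'⟩
    linarith
  refine ⟨t, x, fun i => ?_, heq⟩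
  have h := hz i
  rw [heq] at h
  exact lt_of_le_of_ne (hx.1 i) fun h0 => by simp [← h0] at h

/-- The eigenspace of a positive matrix containing a positive eigenvector is a line. -/
theorem eq_smul_of_pos_eigenvector {ι : Type*} [Fintype ι] [Nonempty ι] {P : Matrix ι ι ℝ}
    (hP : ∀ i j, 0 < P i j) {t : ℝ} {x z : ι → ℝ} (hx : ∀ i, 0 < x i)
    (hPx : P *ᵥ x = t • x) (hPz : P *ᵥ z = t • z) : ∃ s : ℝ, z = s • x := by
  obtain ⟨m, -, hm⟩ := Finset.exists_min_image Finset.univ (fun i => z i / x i)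
    Finset.univ_nonempty
  set s := z m / x m with hs
  refine ⟨s, ?_⟩
  have hnonneg : ∀ i, 0 ≤ (z - s • x) i := by
    intro i
    have := (le_div_iff₀ (hx i)).mp (hm i (Finset.mem_univ i))
    simpa using this
  have hzero : (z - s • x) m = 0 := by
    simp [hs, div_mul_cancel₀ _ (hx m).ne']
  have hP0 : (P *ᵥ (z - s • x)) m = 0 := by
    have : P *ᵥ (z - s • x) = t • (z - s • x) := by
      rw [mulVec_sub, mulVec_smul, hPx, hPz, smul_sub, smul_comm]
    rw [this, Pi.smul_apply, hzero, smul_zero]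
  have hall := (Finset.sum_eq_zero_iff_of_nonneg
    fun j _ => mul_nonneg (hP m j).le (hnonneg j)).mp hP0
  rw [← sub_eq_zero]
  funext j
  exact (mul_eq_zero.mp (hall j (Finset.mem_univ j))).resolve_left (hP m j).ne'

/-- A positive matrix commuting with `B` yields a positive eigenvector of `B`. -/
theorem exists_pos_eigenvector_of_commute {ι : Type*} [Fintype ι] [Nonempty ι]
    {B P : Matrix ι ι ℝ} (hP : ∀ i j, 0 < P i j) (hBP : B * P = P * B) :
    ∃ (l : ℝ) (x : ι → ℝ), (∀ i, 0 < x i) ∧ B *ᵥ x = l • x := by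
  obtain ⟨t, x, hx, hPx⟩ := exists_pos_eigenvector P hP
  have hBx : P *ᵥ (B *ᵥ x) = t • (B *ᵥ x) := by
    rw [mulVec_mulVec, ← hBP, ← mulVec_mulVec, hPx, mulVec_smul]
  obtain ⟨l, hl⟩ := eq_smul_of_pos_eigenvector hP hx hPx hBx
  exact ⟨l, x, hx, hl⟩

/-- `B` has right and left eigenvectors in the standard simplex with a common eigenvalue. -/
def HasSimplexEigenpair {ι : Type*} [Fintype ι] (B : Matrix ι ι ℝ) : Prop :=
  ∃ (l : ℝ) (x y : ι → ℝ), x ∈ stdSimplex ℝ ι ∧ y ∈ stdSimplex ℝ ι ∧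
    B *ᵥ x = l • x ∧ Bᵀ *ᵥ y = l • y

theorem exists_mem_stdSimplex_smul {ι : Type*} [Fintype ι] [Nonempty ι] {x : ι → ℝ}
    (hx : ∀ i, 0 < x i) : ∃ c : ℝ, 0 < c ∧ c • x ∈ stdSimplex ℝ ι := by
  have hS : 0 < ∑ i, x i := Finset.sum_pos (fun i _ => hx i) Finset.univ_nonempty
  refine ⟨(∑ i, x i)⁻¹, inv_pos.mpr hS, fun i => mul_nonneg (inv_nonneg.mpr hS.le) (hx i).le, ?_⟩
  simp only [Pi.smul_apply, smul_eq_mul]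
  rw [← Finset.mul_sum, inv_mul_cancel₀ hS.ne']

theorem AlgPositive.hasSimplexEigenpair {n : ℕ} [NeZero n] {B : Matrix (Fin n) (Fin n) ℝ}
    (hB : AlgPositive B) : HasSimplexEigenpair B := by
  obtain ⟨f, hf⟩ := hB
  have hcomm : B * Polynomial.aeval B f = Polynomial.aeval B f * B := by
    have := (Commute.all Polynomial.X f).map (Polynomial.aeval B)
    simpa using this.eq
  have hcommT : Bᵀ * (Polynomial.aeval B f)ᵀ = (Polynomial.aeval B f)ᵀ * Bᵀ := by
    rw [← transpose_mul, ← transpose_mul, hcomm]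
  obtain ⟨l, x, hx, hBx⟩ := exists_pos_eigenvector_of_commute hf hcomm
  obtain ⟨m, y, hy, hBy⟩ := exists_pos_eigenvector_of_commute (fun i j => hf j i) hcommT
  have hlm : l = m := by
    have h1 : y ⬝ᵥ (B *ᵥ x) = (Bᵀ *ᵥ y) ⬝ᵥ x := by
      rw [dotProduct_mulVec, mulVec_transpose]
    rw [hBx, hBy, dotProduct_smul, smul_dotProduct] at h1
    have h2 : 0 < y ⬝ᵥ x :=
      Finset.sum_pos (fun i _ => mul_pos (hy i) (hx i)) Finset.univ_nonempty
    exact mul_right_cancel₀ h2.ne' h1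
  obtain ⟨c, -, hcx⟩ := exists_mem_stdSimplex_smul hx
  obtain ⟨d, -, hdy⟩ := exists_mem_stdSimplex_smul hy
  refine ⟨l, c • x, d • y, hcx, hdy, ?_, ?_⟩
  · rw [mulVec_smul, hBx, smul_comm]
  · rw [mulVec_smul, hBy, hlm, smul_comm]

theorem isClosed_hasSimplexEigenpair {ι : Type*} [Fintype ι] :
    IsClosed {B : Matrix ι ι ℝ | HasSimplexEigenpair B} := by
  let K : Set ((stdSimplex ℝ ι × stdSimplex ℝ ι) × Matrix ι ι ℝ) :=
    {p | p.2 *ᵥ p.1.1.1 = (∑ i, (p.2 *ᵥ p.1.1.1) i) • p.1.1.1 ∧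
      p.2ᵀ *ᵥ p.1.2.1 = (∑ i, (p.2 *ᵥ p.1.1.1) i) • p.1.2.1}
  have c1 : Continuous fun p : (stdSimplex ℝ ι × stdSimplex ℝ ι) × Matrix ι ι ℝ =>
      p.2 *ᵥ p.1.1.1 := continuous_snd.matrix_mulVec (by fun_prop)
  have c2 : Continuous fun p : (stdSimplex ℝ ι × stdSimplex ℝ ι) × Matrix ι ι ℝ =>
      p.2ᵀ *ᵥ p.1.2.1 := continuous_snd.matrix_transpose.matrix_mulVec (by fun_prop)
  have hK : IsClosed K := by
    refine (isClosed_eq c1 ?_).inter (isClosed_eq c2 ?_) <;> fun_prop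
  convert isClosedMap_snd_of_compactSpace K hK using 1
  ext B
  constructor
  · rintro ⟨l, x, y, hx, hy, h1, h2⟩
    have hl : ∑ i, (B *ᵥ x) i = l := by
      simp only [h1, Pi.smul_apply, smul_eq_mul]
      rw [← Finset.mul_sum, hx.2, mul_one]
    exact ⟨((⟨x, hx⟩, ⟨y, hy⟩), B), ⟨by simp only [hl]; exact h1, by simp only [hl]; exact h2⟩, rfl⟩
  · rintro ⟨⟨⟨⟨x, hx⟩, ⟨y, hy⟩⟩, B'⟩, ⟨h1, h2⟩, rfl⟩
    exact ⟨_, x, y, hx, hy, h1, h2⟩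

/-- Every real matrix subordinate to the sign pattern `A`, with some entries possibly replaced
by zero, has a simplex eigenpair. -/
def RequiresSimplexEigenpair {ι : Type*} [Fintype ι] (A : Matrix ι ι SignType) : Prop :=
  ∀ B : Matrix ι ι ℝ, (∀ i j, B i j = 0 ∨ SignType.sign (B i j) = A i j) →
    HasSimplexEigenpair B

theorem RequiresAP.requiresSimplexEigenpair {n : ℕ} [NeZero n]
    {A : Matrix (Fin n) (Fin n) SignType} (hA : RequiresAP A) :
    RequiresSimplexEigenpair A := by
  intro B hB
  let D : Matrix (Fin n) (Fin n) ℝ := A.map fun s => (s : ℝ)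
  have hmem : ∀ t : ℝ, 0 < t → HasSimplexEigenpair (B + t • D) := by
    intro t ht
    refine (hA _ fun i j => ?_).hasSimplexEigenpair
    have hD : SignType.sign (t * ((A i j : SignType) : ℝ)) = A i j := by
      rw [sign_mul, sign_pos ht, one_mul]
      cases A i j <;> simp
    have hBD : (B + t • D) i j = B i j + t * ((A i j : SignType) : ℝ) := rfl
    rw [hBD]
    rcases hB i j with h | h
    · rw [h, zero_add, hD]
    · rcases lt_trichotomy (B i j) 0 with h0 | h0 | h0
      · rw [← h, sign_neg h0] at hD ⊢
        exact sign_neg (add_neg h0 (sign_eq_neg_one_iff.mp hD))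
      · rw [h0, zero_add, hD]
      · rw [← h, sign_pos h0] at hD ⊢
        exact sign_pos (add_pos h0 (sign_eq_one_iff.mp hD))
  have hc : Continuous fun t : ℝ => B + t • D := by fun_prop
  have hlim : Filter.Tendsto (fun t : ℝ => B + t • D) (nhdsWithin 0 (Set.Ioi 0)) (nhds B) := by
    have := hc.tendsto 0
    simp only [zero_smul, add_zero] at this
    exact this.mono_left nhdsWithin_le_nhds
  exact isClosed_hasSimplexEigenpair.mem_of_tendsto hlim
    (Filter.eventually_of_mem self_mem_nhdsWithin hmem)

theorem RequiresSimplexEigenpair.transpose {ι : Type*} [Fintype ι] {A : Matrix ι ι SignType}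
    (hA : RequiresSimplexEigenpair A) : RequiresSimplexEigenpair Aᵀ := by
  intro B hB
  obtain ⟨l, x, y, hx, hy, h1, h2⟩ := hA Bᵀ fun i j => hB j i
  exact ⟨l, y, x, hy, hx, h2, h1⟩

theorem RequiresSimplexEigenpair.submatrix {ι : Type*} [Fintype ι] {A : Matrix ι ι SignType}
    (hA : RequiresSimplexEigenpair A) (e : ι ≃ ι) :
    RequiresSimplexEigenpair (A.submatrix e e) := by
  intro B hB
  obtain ⟨l, x, y, hx, hy, h1, h2⟩ := hA (B.submatrix e.symm e.symm) fun i j => by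
    simpa using hB (e.symm i) (e.symm j)
  have comp_mem : ∀ v ∈ stdSimplex ℝ ι, v ∘ e ∈ stdSimplex ℝ ι := fun v hv =>
    ⟨fun i => hv.1 (e i), (Equiv.sum_comp e v).trans hv.2⟩
  refine ⟨l, x ∘ e, y ∘ e, comp_mem x hx, comp_mem y hy, ?_, ?_⟩
  · rw [submatrix_mulVec_equiv] at h1
    funext i
    simpa using congrFun h1 (e i)
  · rw [transpose_submatrix, submatrix_mulVec_equiv] at h2
    funext i
    simpa using congrFun h2 (e i)

/-- The eigenvector equations, listed along the cycle, of the forward cycle matrix with two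
additional backward arcs of weights `-2` (from `1` to `0`) and `1` (from `2` to `1`) have no
nonzero nonnegative solution. -/
theorem cyclic_eigen_recurrence_false {n : ℕ} (hn : 3 ≤ n) {l : ℝ} {X Y : ℕ → ℝ}
    (hX : ∀ t, 0 ≤ X t) (hY : ∀ t, 0 ≤ Y t)
    (hXn : X n = X 0) (hXn' : X (n + 1) = X 1)
    (hXne : ∃ t < n, X t ≠ 0) (hYne : ∃ t < n, Y t ≠ 0)
    (hX1 : X 2 - 2 * X 0 = l * X 1) (hX2 : X 3 + X 1 = l * X 2)
    (hXs : ∀ t, 3 ≤ t → t ≤ n → X (t + 1) = l * X t)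
    (hY1 : Y 0 + Y 2 = l * Y 1) (hY0 : Y (n - 1) - 2 * Y 1 = l * Y 0)
    (hYs : ∀ t, 1 ≤ t → t + 1 < n → Y t = l * Y (t + 1)) : False := by
  have hY1pos : 0 < Y 1 := by
    refine lt_of_le_of_ne (hY 1) fun h => ?_
    rw [← h] at hY1 hY0
    have h0 : Y 0 = 0 := by linarith [hY 0, hY 2]
    have hlast : Y (n - 1) = 0 := by rw [h0] at hY0; linarith
    have hdesc : ∀ s, s + 2 ≤ n → Y (n - 1 - s) = 0 := by
      intro s
      induction s with
      | zero => intro _; exact hlast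
      | succ s ih =>
        intro hs
        rw [hYs (n - 1 - (s + 1)) (by omega) (by omega),
          show n - 1 - (s + 1) + 1 = n - 1 - s by omega, ih (by omega), mul_zero]
    obtain ⟨t, ht, hne⟩ := hYne
    apply hne
    rcases Nat.eq_zero_or_pos t with rfl | hpos
    · exact h0
    · have := hdesc (n - 1 - t) (by omega)
      rwa [show n - 1 - (n - 1 - t) = t by omega] at this
  have hl0 : 0 < l := by
    have h := hYs 1 le_rfl (by omega)
    rw [h] at hY1pos
    exact pos_of_mul_pos_left hY1pos (hY 2)
  have hl : 1 ≤ l := by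
    have h : Y 1 = l * Y 2 := hYs 1 le_rfl (by omega)
    have h' : Y 2 ≤ l * Y 1 := by linarith [hY 0]
    have h'' : Y 1 * 1 ≤ Y 1 * l ^ 2 := by nlinarith
    have := le_of_mul_le_mul_left h'' hY1pos
    nlinarith
  have hX0pos : 0 < X 0 := by
    refine lt_of_le_of_ne (hX 0) fun h => ?_
    have h1 : X 1 = 0 := by rw [← hXn', hXs n hn le_rfl, hXn, ← h, mul_zero]
    have h2 : X 2 = 0 := by rw [← h, h1] at hX1; linarith
    have h3 : X 3 = 0 := by rw [h1, h2] at hX2; linarith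
    have hasc : ∀ t, 3 ≤ t → t ≤ n → X t = 0 := by
      intro t ht
      induction t, ht using Nat.le_induction with
      | base => intro _; exact h3
      | succ t ht ih => intro hs; rw [hXs t ht (by omega), ih (by omega), mul_zero]
    obtain ⟨t, ht, hne⟩ := hXne
    apply hne
    rcases lt_or_ge t 3 with h4 | h4
    · interval_cases t
      exacts [h.symm, h1, h2]
    · exact hasc t h4 ht.le
  have hmono : ∀ t, 3 ≤ t → t ≤ n → X 3 ≤ X t := by
    intro t ht
    induction t, ht using Nat.le_induction with
    | base => intro _; exact le_rfl
    | succ t ht ih =>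
      intro hs
      rw [hXs t ht (by omega)]
      exact (ih (by omega)).trans (le_mul_of_one_le_left (hX t) hl)
  have h3 := hmono n hn le_rfl
  have h2 : X 2 = 2 * X 0 + l * X 1 := by linarith
  have h4 : X 3 = 2 * (l * X 0) + (l ^ 2 - 1) * X 1 := by
    rw [h2] at hX2
    linarith
  have h5 : X 0 ≤ l * X 0 := le_mul_of_one_le_left (hX 0) hl
  have h6 : 0 ≤ (l ^ 2 - 1) * X 1 := mul_nonneg (by nlinarith) (hX 1)
  linarith

/-- The forward cycle matrix with two backward arcs of weights `-2` and `1` at `p + 1`. -/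
def cycleTwoBack {n : ℕ} [NeZero n] (p : Fin n) : Matrix (Fin n) (Fin n) ℝ :=
  of fun i j => (if j = i + 1 then 1 else 0) + (if i = p + 1 then if j = p then -2 else 0 else 0) +
    (if i = p + 1 + 1 then if j = p + 1 then 1 else 0 else 0)

theorem cycleTwoBack_mulVec {n : ℕ} [NeZero n] (p : Fin n) (x : Fin n → ℝ) (i : Fin n) :
    (cycleTwoBack p *ᵥ x) i = x (i + 1) + (if i = p + 1 then -2 * x p else 0) +
      (if i = p + 1 + 1 then x (p + 1) else 0) := by
  simp only [cycleTwoBack, mulVec, dotProduct, of_apply, add_mul, Finset.sum_add_distrib]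
  congr 1
  · congr 1
    · simp
    · split_ifs <;> simp
  · split_ifs <;> simp

theorem cycleTwoBack_transpose_mulVec {n : ℕ} [NeZero n] (p : Fin n) (y : Fin n → ℝ)
    (j : Fin n) :
    ((cycleTwoBack p)ᵀ *ᵥ y) (j + 1) = y j + (if j + 1 = p then -2 * y (p + 1) else 0) +
      (if j = p then y (p + 1 + 1) else 0) := by
  simp only [cycleTwoBack, mulVec, dotProduct, transpose_apply, of_apply, add_mul,
    Finset.sum_add_distrib]
  congr 1
  · congr 1
    · simp
    · split_ifs <;> simp
  · simp only [add_left_inj]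
    split_ifs <;> simp

theorem Fin.add_ofNat_eq_iff {n : ℕ} [NeZero n] (p : Fin n) {s t : ℕ} (hs : s < n) (ht : t < n) :
    p + Fin.ofNat n s = p + Fin.ofNat n t ↔ s = t := by
  rw [add_right_inj, Fin.ext_iff]
  simp [Fin.ofNat, Nat.mod_eq_of_lt hs, Nat.mod_eq_of_lt ht]

theorem not_hasSimplexEigenpair_cycleTwoBack {n : ℕ} [NeZero n] (hn : 3 ≤ n) (p : Fin n) :
    ¬ HasSimplexEigenpair (cycleTwoBack p) := by
  rintro ⟨l, x, y, hx, hy, h1, h2⟩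
  let q : ℕ → Fin n := fun t => p + Fin.ofNat n t
  have q0 : q 0 = p := by simp [q]
  have qs : ∀ t, q t + 1 = q (t + 1) := by
    intro t
    simp only [q, add_assoc]
    congr 1
    ext
    simp [Fin.ofNat, Fin.val_add]
  have q1 : q 1 = p + 1 := by rw [← qs, q0]
  have q2 : q 2 = p + 1 + 1 := by rw [← qs, q1]
  have qn : q n = p := by
    simp [q]
  have qinj : ∀ {s t}, s < n → t < n → (q s = q t ↔ s = t) := Fin.add_ofNat_eq_iff p
  have row : ∀ t, x (q (t + 1)) + (if q t = q 1 then -2 * x (q 0) else 0) +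
      (if q t = q 2 then x (q 1) else 0) = l * x (q t) := by
    intro t
    have := congrFun h1 (q t)
    rw [cycleTwoBack_mulVec, qs, ← q2, ← q1, ← q0] at this
    exact this
  have col : ∀ t, y (q t) + (if q (t + 1) = q 0 then -2 * y (q 1) else 0) +
      (if q t = q 0 then y (q 2) else 0) = l * y (q (t + 1)) := by
    intro t
    have := congrFun h2 (q t + 1)
    rw [cycleTwoBack_transpose_mulVec, qs, ← q2, ← q1, ← q0] at this
    exact this
  have exists_ne : ∀ v ∈ stdSimplex ℝ (Fin n), ∃ t < n, v (q t) ≠ 0 := by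
    intro v hv
    by_contra! hzero
    have : v = 0 := by
      funext i
      have hi : q (i - p).val = i := by simp [q]
      rw [← hi]
      exact hzero _ (i - p).isLt
    simpa [this] using hv.2
  have q01 : q 0 ≠ q 1 := fun h => by simpa using (qinj (by omega) (by omega)).mp h
  have q02 : q 0 ≠ q 2 := fun h => by simpa using (qinj (by omega) (by omega)).mp h
  have q12 : q 1 ≠ q 2 := fun h => by simpa using (qinj (by omega) (by omega)).mp h
  refine cyclic_eigen_recurrence_false hn (l := l) (X := fun t => x (q t)) (Y := fun t => y (q t))
    (fun t => hx.1 _) (fun t => hy.1 _) ?_ ?_ (exists_ne x hx) (exists_ne y hy) ?_ ?_ ?_ ?_ ?_ ?_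
  · simp only [qn, q0]
  · simp only [← qs n, qn, q1]
  · have := row 1
    simp only [q12, if_true, if_false] at this
    linarith
  · have := row 2
    simp only [q12.symm, if_true, if_false] at this
    linarith
  · intro t ht htn
    have h := row t
    have ht1 : q t ≠ q 1 ∧ q t ≠ q 2 := by
      rcases htn.lt_or_eq with hlt | rfl
      · constructor <;> intro h <;>
          have := (qinj hlt (by omega)).mp h <;> omega
      · rw [qn, ← q0]
        exact ⟨q01, q02⟩
    simp only [ht1.1, ht1.2, if_false] at h
    linarith
  · have := col 0
    simp only [zero_add, q01.symm, if_true, if_false] at this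
    linarith
  · have h := col (n - 1)
    have hlast : q (n - 1) ≠ q 0 := fun h => by
      have := (qinj (by omega) (by omega)).mp h
      omega
    rw [Nat.sub_add_cancel (by omega), qn, ← q0] at h
    simp only [hlast, if_true, if_false] at h
    linarith
  · intro t ht htn
    have h := col t
    have ht1 : q (t + 1) ≠ q 0 := fun h => by
      have := (qinj htn (by omega)).mp h
      omega
    have ht2 : q t ≠ q 0 := fun h => by
      have := (qinj (by omega) (by omega)).mp h
      omega
    simp only [ht1, ht2, if_false] at h
    linarith

theorem not_requiresSimplexEigenpair_of_forward {n : ℕ} [NeZero n] (hn : 3 ≤ n)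
    {A : Matrix (Fin n) (Fin n) SignType} (hfwd : ∀ i, A i (i + 1) = 1) (p : Fin n)
    (hneg : A (p + 1) p = -1) (hpos : A (p + 1 + 1) (p + 1) = 1) :
    ¬ RequiresSimplexEigenpair A := by
  intro hA
  refine not_hasSimplexEigenpair_cycleTwoBack hn p (hA _ fun i j => ?_)
  have hone : (1 : Fin n) ≠ 0 := fun h => by
    have := congrArg Fin.val h
    change 1 % n = 0 % n at this
    rw [Nat.mod_eq_of_lt (by omega), Nat.zero_mod] at this
    omega
  have htwo : (1 : Fin n) + 1 ≠ 0 := fun h => by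
    have := congrArg Fin.val h
    change (1 % n + 1 % n) % n = 0 % n at this
    rw [Nat.mod_eq_of_lt (a := 1) (by omega), Nat.mod_eq_of_lt (by omega), Nat.zero_mod] at this
    omega
  have hback : ∀ i : Fin n, i ≠ i + 1 + 1 := fun i h => htwo (by
    rw [add_assoc] at h
    simpa using h)
  by_cases h1 : j = i + 1
  · right
    subst h1
    have e1 : ¬ (i = p + 1 ∧ i + 1 = p) := by
      rintro ⟨rfl, h⟩
      exact hback p h.symm
    have e2 : ¬ (i = p + 1 + 1 ∧ i + 1 = p + 1) := by
      rintro ⟨rfl, h⟩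
      exact hback (p + 1) h.symm
    simp only [cycleTwoBack, of_apply, ← ite_and, e1, e2, if_true, if_false, add_zero, hfwd,
      sign_one]
  · by_cases h2 : i = p + 1 ∧ j = p
    · right
      obtain ⟨rfl, rfl⟩ := h2
      simp [cycleTwoBack, hback, hone, hneg]
    · by_cases h3 : i = p + 1 + 1 ∧ j = p + 1
      · right
        obtain ⟨rfl, rfl⟩ := h3
        simp [cycleTwoBack, hback, hone, hpos]
      · left
        simp only [cycleTwoBack, of_apply, ← ite_and, h1, h2, h3, if_false, add_zero]

theorem no_mixed_two_cycles_of_forward {n : ℕ} [NeZero n] (hn : 3 ≤ n)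
    {A : Matrix (Fin n) (Fin n) SignType} (hfwd : ∀ i, A i (i + 1) = 1)
    (hzero : ∀ i j : Fin n, i ≠ j → j ≠ i + 1 → i ≠ j + 1 → A i j = 0)
    (hA : RequiresSimplexEigenpair A) {k j j' : Fin n} (hkj : k ≠ j) (hkj' : k ≠ j')
    (hpos : A k j * A j k = 1) (hneg : A k j' * A j' k = -1) : False := by
  have adj : ∀ i, k ≠ i → A k i * A i k ≠ 0 → i = k + 1 ∨ k = i + 1 := by
    intro i hki hne
    by_contra! h
    exact hne (by rw [hzero k i hki h.1 h.2, zero_mul])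
  rcases adj j hkj (by simp [hpos]) with rfl | rfl <;>
    rcases adj j' hkj' (by simp [hneg]) with h | h
  · subst h
    simp [hneg] at hpos
  · subst h
    rw [hfwd, one_mul] at hpos
    rw [hfwd, mul_one] at hneg
    exact not_requiresSimplexEigenpair_of_forward hn hfwd j' hneg hpos hA
  · subst h
    rw [hfwd, mul_one] at hpos
    rw [hfwd, one_mul] at hneg
    refine not_requiresSimplexEigenpair_of_forward hn (A := (A.submatrix _ _)ᵀ) (fun i => ?_)
      (-(j + 1 + 1)) ?_ ?_ (hA.submatrix (Equiv.neg (Fin n))).transpose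
    · have := hfwd (-(i + 1))
      rwa [show -(i + 1) + 1 = -i by abel] at this
    · rw [show -(j + 1 + 1) + 1 = -(j + 1) by abel]
      simpa only [transpose_apply, submatrix_apply, Equiv.neg_apply, neg_neg] using hneg
    · rw [show -(j + 1 + 1) + 1 + 1 = -j by abel, show -(j + 1 + 1) + 1 = -(j + 1) by abel]
      simpa only [transpose_apply, submatrix_apply, Equiv.neg_apply, neg_neg] using hpos
  · rw [add_left_inj] at h
    subst h
    simp [hneg] at hpos

/-- If `A` is cycle-form, `D(A_+)` contains a directed `n`-cycle, and
`A` requires algebraic positivity, then no vertex is covered by both a positive and a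
negative directed 2-cycle of `D(A)`. -/
theorem stmt_7 {n : ℕ} [NeZero n] (hn : 3 ≤ n) (A : Matrix (Fin n) (Fin n) SignType)
    (hcyc : CycleForm A) (hplus : PlusNCycle A) (hreq : RequiresAP A) :
    ¬ ∃ k j j' : Fin n, k ≠ j ∧ k ≠ j' ∧ A k j * A j k = 1 ∧ A k j' * A j' k = -1 := by
  rintro ⟨k, j, j', hkj, hkj', hpos, hneg⟩
  have hA := hreq.requiresSimplexEigenpair
  rcases hplus with hfwd | hbwd
  · exact no_mixed_two_cycles_of_forward hn hfwd hcyc.1 hA hkj hkj' hpos hneg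
  · refine no_mixed_two_cycles_of_forward hn (A := Aᵀ) hbwd
      (fun i j h1 h2 h3 => hcyc.1 j i h1.symm h3 h2) hA.transpose hkj hkj' ?_ ?_
    · rwa [transpose_apply, transpose_apply, mul_comm]
    · rwa [transpose_apply, transpose_apply, mul_comm]
end

section
/- Let A be an n×n sign pattern of cycle form such that every directed 2-cycle of D(A) is negative, D(A_+) contains a directed cycle of length n, sign(a_{ij} a_{ji}) = − for some i ≠ j, and A requires algebraic positivity. If D(A_-) does not contain a directed cycle of length n and a_{ii} ∈ {-, 0} for all i, then A is SNS. -/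
open Matrix

/-- A sign pattern is sign non-singular if every matrix in its qualitative class
has nonzero determinant. -/
def IsSNS {n : ℕ} (A : Matrix (Fin n) (Fin n) SignType) : Prop :=
  ∀ B : Matrix (Fin n) (Fin n) ℝ, InQClass A B → B.det ≠ 0

section Perron

variable {ι : Type*} [Fintype ι] {P : Matrix ι ι ℝ}

lemma mulVec_pos_of_pos (hP : ∀ i j, 0 < P i j) {z : ι → ℝ} (hz : 0 ≤ z) (hz0 : z ≠ 0) (i : ι) :
    0 < (P *ᵥ z) i := by
  obtain ⟨j, hj⟩ := Function.ne_iff.1 hz0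
  exact Finset.sum_pos' (fun k _ => mul_nonneg (hP i k).le (hz k))
    ⟨j, Finset.mem_univ j, mul_pos (hP i j) (lt_of_le_of_ne (hz j) (Ne.symm hj))⟩

/-- An entrywise positive matrix has a positive eigenvector (Perron). -/
lemma exists_pos_eigenvector_of_pos [Nonempty ι] (hP : ∀ i j, 0 < P i j) :
    ∃ (ρ : ℝ) (x : ι → ℝ), (∀ i, 0 < x i) ∧ P *ᵥ x = ρ • x := by
  classical
  set S : ℝ := ∑ i, ∑ j, P i j with hS
  have hbound : ∀ (ρ : ℝ) (x : ι → ℝ), x ∈ stdSimplex ℝ ι → (∀ i, ρ * x i ≤ (P *ᵥ x) i) →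
      ρ ≤ S := by
    intro ρ x hx h
    calc ρ = ∑ i, ρ * x i := by rw [← Finset.mul_sum, hx.2, mul_one]
      _ ≤ ∑ i, (P *ᵥ x) i := Finset.sum_le_sum fun i _ => h i
      _ ≤ S := Finset.sum_le_sum fun i _ => Finset.sum_le_sum fun j _ =>
          mul_le_of_le_one_right (hP i j).le (mem_Icc_of_mem_stdSimplex hx j).2
  set K : Set (ℝ × (ι → ℝ)) :=
    (Set.Icc 0 S ×ˢ stdSimplex ℝ ι) ∩ {p | ∀ i, p.1 * p.2 i ≤ (P *ᵥ p.2) i} with hK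
  have hKc : IsCompact K := by
    refine (isCompact_Icc.prod (isCompact_stdSimplex ℝ ι)).inter_right ?_
    simp only [Set.ofPred_forall]
    refine isClosed_iInter fun i => isClosed_le (by fun_prop) ?_
    simp only [mulVec, dotProduct]
    fun_prop
  have hKne : K.Nonempty := by
    obtain ⟨i₀⟩ := ‹Nonempty ι›
    refine ⟨(0, Pi.single i₀ 1), ⟨⟨le_rfl, ?_⟩, single_mem_stdSimplex ℝ i₀⟩, fun i => ?_⟩
    · exact Finset.sum_nonneg fun i _ => Finset.sum_nonneg fun j _ => (hP i j).le
    · simp [(hP i i₀).le]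
  obtain ⟨⟨ρ, x⟩, ⟨⟨hρ, hx⟩, hle⟩, hmax⟩ := hKc.exists_isMaxOn hKne continuous_fst.continuousOn
  simp only [Set.mem_ofPred_eq] at hρ hx hle
  have hx0 : x ≠ 0 := by
    rintro rfl
    simpa using hx.2
  have hy := mulVec_pos_of_pos hP (fun i => hx.1 i) hx0
  have heq : P *ᵥ x = ρ • x := by
    by_contra hne
    have hz := mulVec_pos_of_pos hP (z := P *ᵥ x - ρ • x)
      (fun i => by simpa using hle i) (sub_ne_zero.2 hne)
    simp only [mulVec_sub, mulVec_smul, Pi.sub_apply, Pi.smul_apply, smul_eq_mul, sub_pos] at hz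
    set y := P *ᵥ x with hydef
    obtain ⟨m, -, hm⟩ := Finset.exists_min_image Finset.univ (fun i => (P *ᵥ y) i / y i)
      Finset.univ_nonempty
    set ρ' := (P *ᵥ y) m / y m with hρ'
    have hlt : ρ < ρ' := (lt_div_iff₀ (hy m)).2 (hz m)
    have hsum : 0 < ∑ i, y i := Finset.sum_pos (fun i _ => hy i) Finset.univ_nonempty
    have hmem : (∑ i, y i)⁻¹ • y ∈ stdSimplex ℝ ι := by
      refine ⟨fun i => mul_nonneg (inv_nonneg.2 hsum.le) (hy i).le, ?_⟩
      simp only [Pi.smul_apply, smul_eq_mul, ← Finset.mul_sum]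
      exact inv_mul_cancel₀ hsum.ne'
    have hle' : ∀ i, ρ' * ((∑ i, y i)⁻¹ • y) i ≤ (P *ᵥ ((∑ i, y i)⁻¹ • y)) i := by
      intro i
      rw [mulVec_smul, Pi.smul_apply, Pi.smul_apply, smul_eq_mul, smul_eq_mul, mul_left_comm]
      exact mul_le_mul_of_nonneg_left ((le_div_iff₀ (hy i)).1 (hm i (Finset.mem_univ i)))
        (inv_nonneg.2 hsum.le)
    have := hmax (a := (ρ', (∑ i, y i)⁻¹ • y))
      ⟨⟨⟨hρ.1.trans hlt.le, hbound _ _ hmem hle'⟩, hmem⟩, hle'⟩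
    exact absurd this (not_le.2 hlt)
  refine ⟨ρ, x, fun i => ?_, heq⟩
  have h1 := hy i
  rw [heq, Pi.smul_apply, smul_eq_mul] at h1
  exact pos_of_mul_pos_right h1 hρ.1

/-- The eigenspace of a positive matrix at a positive eigenvector is one-dimensional. -/
lemma exists_eq_smul_of_mulVec_eq [Nonempty ι] (hP : ∀ i j, 0 < P i j) {ρ : ℝ} {x z : ι → ℝ}
    (hx : ∀ i, 0 < x i) (hPx : P *ᵥ x = ρ • x) (hPz : P *ᵥ z = ρ • z) :
    ∃ t : ℝ, z = t • x := by
  obtain ⟨m, -, hm⟩ := Finset.exists_min_image Finset.univ (fun i => z i / x i)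
    Finset.univ_nonempty
  refine ⟨z m / x m, ?_⟩
  by_contra hne
  have hpos := mulVec_pos_of_pos hP (z := z - (z m / x m) • x)
    (fun i => by
      have := (le_div_iff₀ (hx i)).1 (hm i (Finset.mem_univ i))
      simpa using this) (sub_ne_zero.2 hne) m
  rw [mulVec_sub, mulVec_smul, hPx, hPz] at hpos
  simp only [Pi.sub_apply, Pi.smul_apply, smul_eq_mul] at hpos
  have : z m / x m * (ρ * x m) = ρ * z m := by
    have := (hx m).ne'
    field_simp
  linarith

end Perron

lemma AlgPositive.exists_pos_eigenvector {n : ℕ} [NeZero n] {M : Matrix (Fin n) (Fin n) ℝ}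
    (h : AlgPositive M) :
    ∃ (μ : ℝ) (x : Fin n → ℝ), (∀ i, 0 < x i) ∧ ∀ i, (M *ᵥ x) i = μ * x i := by
  obtain ⟨f, hf⟩ := h
  obtain ⟨ρ, x, hx, hPx⟩ := exists_pos_eigenvector_of_pos hf
  have hcomm : Polynomial.aeval M f * M = M * Polynomial.aeval M f := by
    simpa using congrArg (Polynomial.aeval M) (mul_comm f Polynomial.X)
  obtain ⟨μ, hμ⟩ := exists_eq_smul_of_mulVec_eq hf (z := M *ᵥ x) hx hPx
    (by rw [mulVec_mulVec, hcomm, ← mulVec_mulVec, hPx, mulVec_smul])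
  exact ⟨μ, x, hx, fun i => by rw [hμ]; rfl⟩

lemma AlgPositive.transpose {n : ℕ} {M : Matrix (Fin n) (Fin n) ℝ} (h : AlgPositive M) :
    AlgPositive Mᵀ := by
  obtain ⟨f, hf⟩ := h
  refine ⟨f, fun i j => ?_⟩
  have : Polynomial.aeval Mᵀ f = (Polynomial.aeval M f)ᵀ := by
    simp [Polynomial.aeval_eq_sum_range, transpose_sum, transpose_pow, transpose_smul]
  rw [this]
  exact hf j i

/-- The real matrix with sign pattern `A` and absolute values `w` on the support of `A`. -/
def weighted {n : ℕ} (A : Matrix (Fin n) (Fin n) SignType) (w : Fin n → Fin n → ℝ) :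
    Matrix (Fin n) (Fin n) ℝ :=
  of fun i j => (A i j : ℝ) * w i j

lemma inQClass_weighted {n : ℕ} (A : Matrix (Fin n) (Fin n) SignType)
    {w : Fin n → Fin n → ℝ} (hw : ∀ i j, 0 < w i j) : InQClass A (weighted A w) := by
  intro i j
  rw [weighted, of_apply, sign_mul, sign_pos (hw i j), mul_one]
  cases A i j <;> simp

lemma SignType.eq_zero_or_eq_neg_one {s : SignType} (h : s ≠ 1) : s = 0 ∨ s = -1 := by
  revert s
  decide

lemma RequiresAP.transpose {n : ℕ} {A : Matrix (Fin n) (Fin n) SignType}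
    (hreq : RequiresAP A) : RequiresAP Aᵀ := fun B hB =>
  (hreq Bᵀ fun i j => hB j i).transpose

lemma IsSNS.of_transpose {n : ℕ} {A : Matrix (Fin n) (Fin n) SignType} (h : IsSNS Aᵀ) :
    IsSNS A := fun B hB =>
  det_transpose B ▸ h Bᵀ fun i j => hB j i

section Cyclic

variable {n : ℕ} [NeZero n]

lemma Fin.forall_of_forall_add_one {p : Fin n → Prop} (r : Fin n) (hr : p r)
    (h : ∀ i, p i → p (i + 1)) (i : Fin n) : p i := by
  have hk : ∀ k : ℕ, p (r + Fin.ofNat n k) := by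
    intro k
    induction k with
    | zero => simpa using hr
    | succ k ih =>
      have : r + Fin.ofNat n (k + 1) = r + Fin.ofNat n k + 1 := by
        rw [add_assoc]
        congr 1
        ext
        simp [Fin.val_add]
      rw [this]
      exact h _ ih
  have := hk (i - r).val
  rwa [Fin.ofNat_val_eq_self, add_sub_cancel] at this

lemma Fin.add_one_ne_self (hn : 3 ≤ n) (i : Fin n) : i + 1 ≠ i := by
  intro h
  have h1 : (1 : Fin n) = 0 := by simpa using h
  have := congrArg Fin.val h1
  rw [Fin.val_one', Nat.mod_eq_of_lt (by omega)] at this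
  simp at this

lemma Fin.add_one_add_one_ne_self (hn : 3 ≤ n) (i : Fin n) : i + 1 + 1 ≠ i := by
  intro h
  have h1 : (1 + 1 : Fin n) = 0 := by simpa [add_assoc] using h
  have := congrArg Fin.val h1
  rw [Fin.val_add, Fin.val_one', Nat.mod_eq_of_lt (show 1 < n by omega),
    Nat.mod_eq_of_lt (by omega)] at this
  simp at this

/-- The product of a matrix supported on the diagonal and the cycle with a vector. -/
lemma mulVec_add_one_of_cyclic (hn : 3 ≤ n) {M : Matrix (Fin n) (Fin n) ℝ}
    (hM : ∀ i j : Fin n, i ≠ j → j ≠ i + 1 → i ≠ j + 1 → M i j = 0) (x : Fin n → ℝ) (i : Fin n) :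
    (M *ᵥ x) (i + 1) =
      M (i + 1) i * x i + M (i + 1) (i + 1) * x (i + 1) +
        M (i + 1) (i + 1 + 1) * x (i + 1 + 1) := by
  have h1 := Fin.add_one_ne_self hn i
  have h2 := Fin.add_one_ne_self hn (i + 1)
  have h3 := Fin.add_one_add_one_ne_self hn i
  have hs : ∑ j ∈ ({i, i + 1, i + 1 + 1} : Finset (Fin n)), M (i + 1) j * x j =
      ∑ j, M (i + 1) j * x j := by
    refine Finset.sum_subset (Finset.subset_univ _) fun j _ hj => ?_
    simp only [Finset.mem_insert, Finset.mem_singleton, not_or] at hj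
    rw [hM _ _ (Ne.symm hj.2.1) hj.2.2 (fun h => hj.1 (add_right_cancel h).symm), zero_mul]
  rw [mulVec, dotProduct, ← hs, Finset.sum_insert, Finset.sum_insert, Finset.sum_singleton]
  · ring
  · simpa using h2.symm
  · simp only [Finset.mem_insert, Finset.mem_singleton, not_or]
    exact ⟨h1.symm, h3.symm⟩

variable {A : Matrix (Fin n) (Fin n) SignType}

/-- A singular matrix in the class has, when row `r + 1` of the pattern has no negative entry, a
nonzero nonnegative vector in its kernel, whose support is described by the pattern alone. -/
lemma exists_support_of_det_eq_zero (hn : 3 ≤ n)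
    (hoff : ∀ i j : Fin n, i ≠ j → j ≠ i + 1 → i ≠ j + 1 → A i j = 0)
    (hforw : ∀ i : Fin n, A i (i + 1) = 1) (hback : ∀ i : Fin n, A (i + 1) i ≠ 1)
    (hdiag : ∀ i : Fin n, A i i ≠ 1) {r : Fin n} (hr : A (r + 1) r = 0)
    (hr' : A (r + 1) (r + 1) = 0) {B : Matrix (Fin n) (Fin n) ℝ} (hB : InQClass A B)
    (hdet : B.det = 0) :
    ∃ T : Finset (Fin n), T.Nonempty ∧ ∀ i, i + 1 + 1 ∈ T →
      (A (i + 1) i = -1 ∧ i ∈ T) ∨ (A (i + 1) (i + 1) = -1 ∧ i + 1 ∈ T) := by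
  have hBoff : ∀ i j : Fin n, i ≠ j → j ≠ i + 1 → i ≠ j + 1 → B i j = 0 := fun i j h1 h2 h3 =>
    sign_eq_zero_iff.1 ((hB i j).trans (hoff i j h1 h2 h3))
  have hf : ∀ i, 0 < B i (i + 1) := fun i => sign_eq_one_iff.1 ((hB _ _).trans (hforw i))
  have hnonpos : ∀ i j, A i j ≠ 1 → B i j ≤ 0 := fun i j h =>
    not_lt.1 fun h' => h ((hB i j).symm.trans (sign_pos h'))
  have hzero : ∀ i j, A i j = 0 → B i j = 0 := fun i j h => sign_eq_zero_iff.1 ((hB i j).trans h)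
  obtain ⟨v, hv0, hv, hvr⟩ : ∃ v : Fin n → ℝ, v ≠ 0 ∧ B *ᵥ v = 0 ∧ 0 ≤ v (r + 1) := by
    obtain ⟨v, hv0, hv⟩ := exists_mulVec_eq_zero_iff.2 hdet
    rcases le_total 0 (v (r + 1)) with h | h
    · exact ⟨v, hv0, hv, h⟩
    · exact ⟨-v, neg_ne_zero.2 hv0, by rw [mulVec_neg, hv, neg_zero], neg_nonneg.2 h⟩
  have hrec : ∀ i, B (i + 1) i * v i + B (i + 1) (i + 1) * v (i + 1) +
      B (i + 1) (i + 1 + 1) * v (i + 1 + 1) = 0 := fun i => by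
    rw [← mulVec_add_one_of_cyclic hn hBoff, hv, Pi.zero_apply]
  have hnn : ∀ i, 0 ≤ v i ∧ 0 ≤ v (i + 1) := by
    refine Fin.forall_of_forall_add_one (r + 1) ⟨hvr, ?_⟩ fun i hi => ⟨hi.2, ?_⟩
    · have := hrec r
      rw [hzero _ _ hr, hzero _ _ hr', zero_mul, zero_mul, zero_add, zero_add] at this
      exact ((mul_eq_zero.1 this).resolve_left (hf _).ne').ge
    · have h1 := mul_nonneg (neg_nonneg.2 (hnonpos _ _ (hback i))) hi.1
      have h2 := mul_nonneg (neg_nonneg.2 (hnonpos _ _ (hdiag (i + 1)))) hi.2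
      exact nonneg_of_mul_nonneg_right (by linarith [hrec i]) (hf (i + 1))
  refine ⟨Finset.univ.filter fun i => v i ≠ 0, ?_, fun i hi => ?_⟩
  · obtain ⟨i, hi⟩ := Function.ne_iff.1 hv0
    exact ⟨i, by simpa using hi⟩
  · simp only [Finset.mem_filter, Finset.mem_univ, true_and] at hi ⊢
    by_contra! hcon
    have h1 : B (i + 1) i * v i = 0 := by
      rcases SignType.eq_zero_or_eq_neg_one (hback i) with h | h
      · rw [hzero _ _ h, zero_mul]
      · rw [hcon.1 h, mul_zero]
    have h2 : B (i + 1) (i + 1) * v (i + 1) = 0 := by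
      rcases SignType.eq_zero_or_eq_neg_one (hdiag (i + 1)) with h | h
      · rw [hzero _ _ h, zero_mul]
      · rw [hcon.2 h, mul_zero]
    have := hrec i
    rw [h1, h2, add_zero, zero_add] at this
    exact (mul_ne_zero (hf (i + 1)).ne' hi) this

lemma weighted_eq_zero {w : Fin n → Fin n → ℝ}
    (hoff : ∀ i j : Fin n, i ≠ j → j ≠ i + 1 → i ≠ j + 1 → A i j = 0) (i j : Fin n) (h : i ≠ j)
    (h₁ : j ≠ i + 1) (h₂ : i ≠ j + 1) : weighted A w i j = 0 := by
  simp [weighted, hoff i j h h₁ h₂]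

lemma RequiresAP.det_ne_zero_of_nonneg_row (hreq : RequiresAP A) (hn : 3 ≤ n)
    (hoff : ∀ i j : Fin n, i ≠ j → j ≠ i + 1 → i ≠ j + 1 → A i j = 0)
    (hforw : ∀ i : Fin n, A i (i + 1) = 1) (hback : ∀ i : Fin n, A (i + 1) i ≠ 1)
    (hdiag : ∀ i : Fin n, A i i ≠ 1) {r : Fin n} (hr : A (r + 1) r = 0)
    (hr' : A (r + 1) (r + 1) = 0) : IsSNS A := by
  intro B hB hdet
  obtain ⟨T, hT, hTs⟩ := exists_support_of_det_eq_zero hn hoff hforw hback hdiag hr hr' hB hdet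
  set w : Fin n → Fin n → ℝ := fun i j => if j = i + 1 then 1 else 2 with hw
  obtain ⟨μ, x, hx, hμ⟩ := (hreq (weighted A w) (inQClass_weighted A fun i j => by
    simp only [hw]; split_ifs <;> norm_num)).exists_pos_eigenvector
  have hrec : ∀ i, x (i + 1 + 1) = (μ - A (i + 1) (i + 1) * 2) * x (i + 1)
      - A (i + 1) i * 2 * x i := fun i => by
    have := hμ (i + 1)
    rw [mulVec_add_one_of_cyclic hn (weighted_eq_zero hoff)] at this
    simp only [weighted, of_apply, hw, hforw, if_true,
      (Fin.add_one_ne_self hn (i + 1)).symm, (Fin.add_one_add_one_ne_self hn i).symm, if_false,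
      SignType.coe_one] at this
    linarith
  have hμ0 : 0 ≤ μ := by
    have := hrec r
    simp only [hr, hr', SignType.coe_zero] at this
    exact (pos_of_mul_pos_left (by linarith [hx (r + 1 + 1)]) (hx (r + 1)).le).le
  obtain ⟨m, hm, hmin⟩ := T.exists_min_image x hT
  obtain ⟨i, rfl⟩ : ∃ i : Fin n, m = i + 1 + 1 := ⟨m - 1 - 1, by simp⟩
  have key : ∀ i j, A i j ≠ 1 → (A i j : ℝ) ≤ 0 := fun i j h => by
    rcases SignType.eq_zero_or_eq_neg_one h with h | h <;> simp [h]
  have h1 := mul_nonneg (neg_nonneg.2 (key _ _ (hback i))) (hx i).le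
  have h2 := mul_nonneg (neg_nonneg.2 (key _ _ (hdiag (i + 1)))) (hx (i + 1)).le
  have h3 := mul_nonneg hμ0 (hx (i + 1)).le
  have h4 := hrec i
  rcases hTs i hm with ⟨h, hi⟩ | ⟨h, hi⟩
  · rw [h] at h4 h1
    simp only [SignType.coe_neg, SignType.coe_one] at h4 h1
    linarith [hmin i hi, hx i]
  · rw [h] at h4 h2
    simp only [SignType.coe_neg, SignType.coe_one] at h4 h2
    linarith [hmin _ hi, hx (i + 1)]

/-- If every row has a negative entry and some edge of the cycle carries a negative backward arc
while the next edge does not, then some matrix of the class is not algebraically positive. -/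
lemma not_requiresAP_of_neg_rows (hn : 3 ≤ n)
    (hoff : ∀ i j : Fin n, i ≠ j → j ≠ i + 1 → i ≠ j + 1 → A i j = 0)
    (hforw : ∀ i : Fin n, A i (i + 1) = 1) (hback : ∀ i : Fin n, A (i + 1) i ≠ 1)
    (hdiag : ∀ i : Fin n, A i i ≠ 1)
    (hrow : ∀ i : Fin n, A (i + 1) i = -1 ∨ A (i + 1) (i + 1) = -1) {k : Fin n}
    (hk : A (k + 1) k = -1) (hk' : A (k + 1 + 1) (k + 1) = 0) : ¬ RequiresAP A := by
  intro hreq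
  set w : Fin n → Fin n → ℝ := fun i j =>
    if j = i + 1 then 1 else if i = k + 1 ∧ j = k + 1 then 1 / 2 else 2 with hw
  obtain ⟨μ, y, hy, hμ⟩ := (hreq (weighted A w) (inQClass_weighted A fun i j => by
    simp only [hw]; split_ifs <;> norm_num)).transpose.exists_pos_eigenvector
  have hrec : ∀ i, y i = (μ - A (i + 1) (i + 1) * (if i = k then 1 / 2 else 2)) * y (i + 1)
      - A (i + 1 + 1) (i + 1) * 2 * y (i + 1 + 1) := fun i => by
    have := hμ (i + 1)
    rw [mulVec_add_one_of_cyclic hn (M := (weighted A w)ᵀ)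
      (fun i j h h₁ h₂ => weighted_eq_zero hoff j i h.symm h₂ h₁)] at this
    have h5 : ¬ (i + 1 = k ∧ i = k) := fun h =>
      Fin.add_one_ne_self hn i (h.1.trans h.2.symm)
    simp only [transpose_apply, weighted, of_apply, hw, hforw, if_true, h5,
      (Fin.add_one_ne_self hn (i + 1)).symm, (Fin.add_one_add_one_ne_self hn (i + 1)).symm,
      if_false, SignType.coe_one, and_self, add_left_inj] at this
    linarith
  have key : ∀ i j, A i j ≠ 1 → (A i j : ℝ) ≤ 0 := fun i j h => by
    rcases SignType.eq_zero_or_eq_neg_one h with h | h <;> simp [h]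
  have hμ0 : -(1 / 2) < μ := by
    have h1 := hrec k
    simp only [hk', SignType.coe_zero, if_true] at h1
    have h2 : 0 < μ - A (k + 1) (k + 1) * (1 / 2) :=
      pos_of_mul_pos_left (by linarith [hy k]) (hy (k + 1)).le
    rcases SignType.eq_zero_or_eq_neg_one (hdiag (k + 1)) with h | h <;>
      simp only [h, SignType.coe_zero, SignType.coe_neg, SignType.coe_one] at h2 <;> linarith
  obtain ⟨m, hmax⟩ := Finite.exists_max y
  obtain ⟨i, rfl⟩ : ∃ i : Fin n, m = i + 1 + 1 := ⟨m - 1 - 1, by simp⟩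
  have hback' := mul_nonneg (neg_nonneg.2 (key _ _ (hback (i + 1 + 1)))) (hy (i + 1 + 1 + 1)).le
  have hm := hy (i + 1 + 1)
  by_cases h : A (i + 1 + 1) (i + 1) = -1
  · have h4 := hrec i
    have h3 := mul_pos (neg_lt_iff_pos_add.1 hμ0) (hy (i + 1))
    have h2 : 0 ≤ -((A (i + 1) (i + 1) : ℝ) * (if i = k then 1 / 2 else 2)) * y (i + 1) := by
      rw [← neg_mul]
      refine mul_nonneg (mul_nonneg (neg_nonneg.2 (key _ _ (hdiag _))) ?_) (hy _).le
      split_ifs <;> norm_num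
    rw [h] at h4
    simp only [SignType.coe_neg, SignType.coe_one] at h4
    linarith [hmax i, hmax (i + 1)]
  · have hne : i + 1 ≠ k := by
      rintro rfl
      exact h hk
    have h4 := hrec (i + 1)
    rw [(hrow (i + 1)).resolve_left h, if_neg hne] at h4
    simp only [SignType.coe_neg, SignType.coe_one] at h4
    have h3 := mul_pos (neg_lt_iff_pos_add.1 hμ0) hm
    linarith [hmax (i + 1)]

lemma RequiresAP.isSNS_of_forward (hreq : RequiresAP A) (hn : 3 ≤ n)
    (hoff : ∀ i j : Fin n, i ≠ j → j ≠ i + 1 → i ≠ j + 1 → A i j = 0)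
    (hneg2 : ∀ i j : Fin n, i ≠ j → A i j ≠ 0 → A j i ≠ 0 → A i j * A j i = -1)
    (hforw : ∀ i : Fin n, A i (i + 1) = 1)
    (hex : ∃ i j : Fin n, i ≠ j ∧ A i j * A j i = -1)
    (hminus : ¬ ∀ i : Fin n, A (i + 1) i = -1) (hdiag : ∀ i : Fin n, A i i ≠ 1) : IsSNS A := by
  have hback : ∀ i : Fin n, A (i + 1) i ≠ 1 := fun i h => by
    have := hneg2 i (i + 1) (Fin.add_one_ne_self hn i).symm (by simp [hforw]) (by simp [h])
    rw [hforw, h] at this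
    exact absurd this (by decide)
  by_cases hrow : ∀ i : Fin n, A (i + 1) i = -1 ∨ A (i + 1) (i + 1) = -1
  · obtain ⟨s, hs⟩ : ∃ s : Fin n, A (s + 1) s = -1 := by
      obtain ⟨i, j, hij, h⟩ := hex
      by_cases h1 : j = i + 1
      · subst h1
        exact ⟨i, by simpa [hforw] using h⟩
      · by_cases h2 : i = j + 1
        · subst h2
          exact ⟨j, by simpa [hforw] using h⟩
        · rw [hoff i j hij h1 h2, zero_mul] at h
          exact absurd h (by decide)
    obtain ⟨k, hk, hk'⟩ : ∃ k : Fin n, A (k + 1) k = -1 ∧ A (k + 1 + 1) (k + 1) ≠ -1 := by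
      by_contra! hcon
      exact hminus (Fin.forall_of_forall_add_one s hs hcon)
    exact absurd hreq (not_requiresAP_of_neg_rows hn hoff hforw hback hdiag hrow hk
      ((SignType.eq_zero_or_eq_neg_one (hback (k + 1))).resolve_right hk'))
  · push Not at hrow
    obtain ⟨r, hr, hr'⟩ := hrow
    exact hreq.det_ne_zero_of_nonneg_row hn hoff hforw hback hdiag
      ((SignType.eq_zero_or_eq_neg_one (hback r)).resolve_right hr)
      ((SignType.eq_zero_or_eq_neg_one (hdiag (r + 1))).resolve_right hr')

end Cyclic

/-- Cycle-form `A` with all directed 2-cycles negative, a directed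
`n`-cycle in `D(A_+)`, some negative 2-cycle, and requiring algebraic positivity:
if `D(A_-)` has no directed `n`-cycle and the diagonal is nonpositive, then `A` is SNS. -/
theorem stmt_12 {n : ℕ} [NeZero n] (hn : 3 ≤ n) (A : Matrix (Fin n) (Fin n) SignType)
    (hcyc : CycleForm A)
    (hneg2 : ∀ i j : Fin n, i ≠ j → A i j ≠ 0 → A j i ≠ 0 → A i j * A j i = -1)
    (hplus : PlusNCycle A)
    (hex : ∃ i j : Fin n, i ≠ j ∧ A i j * A j i = -1)
    (hreq : RequiresAP A)
    (hminus : ¬ MinusNCycle A) (hdiag : ∀ i : Fin n, A i i ≠ 1) :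
    IsSNS A := by
  rw [MinusNCycle, not_or] at hminus
  rcases hplus with h | h
  · exact hreq.isSNS_of_forward hn hcyc.1 hneg2 h hex hminus.2 hdiag
  · refine (hreq.transpose.isSNS_of_forward hn (fun i j h₀ h₁ h₂ => hcyc.1 j i h₀.symm h₂ h₁)
      (fun i j h₀ h₁ h₂ => hneg2 j i h₀.symm h₁ h₂) h ?_ hminus.1 hdiag).of_transpose
    obtain ⟨i, j, hij, h'⟩ := hex
    exact ⟨j, i, hij.symm, h'⟩
end
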